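/- arXiv:1703.07199 — 2 statements merged into one kernel-verified Lean document; each statement's English description precedes it below -/
import Mathlib

section
/- Let F ∈ R = K[x_1,...,x_n] be a homogeneous polynomial of degree n whose partial derivatives ∂F/∂x_1, ..., ∂F/∂x_n are linearly independent over K. Then the ideal Ann_R(F) is generated by a regular sequence of n homogeneous quadratic forms (i.e. A(F) is a quadratic complete intersection) if and only if the quadratic space Q(F) = Ann_R(F)_2 contains a regular sequence of length n in R. -/
open MvPolynomial

noncomputable section

variable {K : Type} [Field K] {n : ℕ}

/-- The endomorphism `∂^d = ∏ i, (∂/∂x_i)^{d i}`. -/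
def monOp (n : ℕ) (K : Type) [CommSemiring K] (d : Fin n →₀ ℕ) :
    Module.End K (MvPolynomial (Fin n) K) :=
  ((List.finRange n).map fun i =>
    ((MvPolynomial.pderiv i).toLinearMap : Module.End K (MvPolynomial (Fin n) K)) ^ d i).prod

/-- `contr F f = f(∂/∂x₁, …, ∂/∂xₙ) F`, i.e. the result of applying to `F` the
constant-coefficient differential operator obtained from `f` by substituting
`∂/∂x_i` for `x_i`; it is a linear map in `f`. -/
def contr (F : MvPolynomial (Fin n) K) :
    MvPolynomial (Fin n) K →ₗ[K] MvPolynomial (Fin n) K :=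
  (basisMonomials (Fin n) K).constr K fun d => monOp n K d F

end

section RegularSequences

variable {R : Type*} [CommRing R]

/-- `a` is a nonzerodivisor on `R ⧸ I`. -/
def NonzerodivisorMod (I : Ideal R) (a : R) : Prop := ∀ p, a * p ∈ I → p ∈ I

/-- The list `l` is a weakly regular sequence on `R ⧸ I`. -/
def WeaklyRegularMod : Ideal R → List R → Prop
  | _, [] => True
  | I, a :: l => NonzerodivisorMod I a ∧ WeaklyRegularMod (I ⊔ Ideal.span {a}) l

/-- `w` is a nonzerodivisor modulo `I` together with any proper initial segment of the list. -/
def NonzerodivisorAlong (w : R) : Ideal R → List R → Prop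
  | _, [] => True
  | I, a :: l => NonzerodivisorMod I w ∧ NonzerodivisorAlong w (I ⊔ Ideal.span {a}) l

/-- Every nonzero element of `R ⧸ I` killed by `m` generates the socle `(I : m) ⧸ I`. -/
def SimpleSocle (m I : Ideal R) : Prop :=
  ∀ g h, (∀ x ∈ m, x * g ∈ I) → (∀ x ∈ m, x * h ∈ I) → g ∉ I → ∃ r, h - r * g ∈ I

lemma mem_sup_span_singleton {I : Ideal R} {a p : R} :
    p ∈ I ⊔ Ideal.span {a} ↔ ∃ k, p - a * k ∈ I := by
  rw [sup_comm, Submodule.mem_sup]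
  constructor
  · rintro ⟨y, hy, z, hz, rfl⟩
    obtain ⟨k, rfl⟩ := Ideal.mem_span_singleton'.1 hy
    exact ⟨k, by convert hz using 1; ring⟩
  · rintro ⟨k, hk⟩
    exact ⟨a * k, Ideal.mem_span_singleton.2 (dvd_mul_right a k), _, hk, by ring⟩

lemma SimpleSocle.exchange {m I : Ideal R} {a b : R} (ha : NonzerodivisorMod I a)
    (hb : NonzerodivisorMod I b) (hbm : b ∈ m)
    (H : SimpleSocle m (I ⊔ Ideal.span {b})) : SimpleSocle m (I ⊔ Ideal.span {a}) := by
  have key : ∀ g, (∀ x ∈ m, x * g ∈ I ⊔ Ideal.span {a}) →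
      ∃ g', b * g - a * g' ∈ I ∧ ∀ x ∈ m, x * g' ∈ I ⊔ Ideal.span {b} := by
    intro g hg
    obtain ⟨g', hg'⟩ := mem_sup_span_singleton.1 (hg b hbm)
    refine ⟨g', hg', fun x hx => ?_⟩
    obtain ⟨k, hk⟩ := mem_sup_span_singleton.1 (hg x hx)
    refine mem_sup_span_singleton.2 ⟨k, ha _ ?_⟩
    have := I.sub_mem (I.mul_mem_left b hk) (I.mul_mem_left x hg')
    convert this using 1
    ring
  intro g h hg hh hgI
  obtain ⟨g', hg1, hg2⟩ := key g hg
  obtain ⟨h', hh1, hh2⟩ := key h hh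
  have hg'I : g' ∉ I ⊔ Ideal.span {b} := by
    intro hc
    obtain ⟨k, hk⟩ := mem_sup_span_singleton.1 hc
    refine hgI (mem_sup_span_singleton.2 ⟨k, hb _ ?_⟩)
    convert I.add_mem hg1 (I.mul_mem_left a hk) using 1
    ring
  obtain ⟨r, hr⟩ := H g' h' hg2 hh2 hg'I
  obtain ⟨k, hk⟩ := mem_sup_span_singleton.1 hr
  refine ⟨r, mem_sup_span_singleton.2 ⟨k, hb _ ?_⟩⟩
  convert I.add_mem (I.sub_mem hh1 (I.mul_mem_left r hg1)) (I.mul_mem_left a hk) using 1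
  ring

/-- A weakly regular sequence can be traded for one starting with a sufficiently general `w`,
without changing whether the socle of the quotient is simple. -/
lemma WeaklyRegularMod.exists_cons {m : Ideal R} {w : R} (hw : w ∈ m) (y : List R) :
    ∀ I : Ideal R, y ≠ [] → (∀ a ∈ y, a ∈ m) → WeaklyRegularMod I y →
      NonzerodivisorAlong w I y →
      ∃ y' : List R, y'.length + 1 = y.length ∧ (∀ a ∈ y', a ∈ m) ∧
        WeaklyRegularMod (I ⊔ Ideal.span {w}) y' ∧
        (SimpleSocle m (I ⊔ Ideal.ofList y) ↔
          SimpleSocle m (I ⊔ Ideal.span {w} ⊔ Ideal.ofList y')) := by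
  induction y with
  | nil => intro I h; exact absurd rfl h
  | cons a y ih =>
    intro I _ hm hreg hgen
    have ham : a ∈ m := hm a (by simp)
    by_cases hy : y = []
    · subst hy
      refine ⟨[], rfl, by simp, trivial, ?_⟩
      simp only [Ideal.ofList_cons, Ideal.ofList_nil, sup_bot_eq]
      exact ⟨SimpleSocle.exchange hgen.1 hreg.1 ham, SimpleSocle.exchange hreg.1 hgen.1 hw⟩
    · obtain ⟨y'', hlen, hm', hreg', hiff⟩ :=
        ih (I ⊔ Ideal.span {a}) hy (fun b hb => hm b (by simp [hb])) hreg.2 hgen.2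
      refine ⟨a :: y'', by simp [hlen], ?_, ⟨?_, ?_⟩, ?_⟩
      · simpa using ⟨ham, hm'⟩
      · intro p hp
        obtain ⟨q, hq⟩ := mem_sup_span_singleton.1 hp
        have hwa : NonzerodivisorMod (I ⊔ Ideal.span {a}) w := by
          cases y with
          | nil => exact absurd rfl hy
          | cons b y => exact hgen.2.1
        have hq' : q ∈ I ⊔ Ideal.span {a} := by
          refine hwa _ (mem_sup_span_singleton.2 ⟨p, ?_⟩)
          convert I.neg_mem hq using 1
          ring
        obtain ⟨s, hs⟩ := mem_sup_span_singleton.1 hq'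
        refine mem_sup_span_singleton.2 ⟨s, hreg.1 _ ?_⟩
        convert I.add_mem hq (I.mul_mem_left w hs) using 1
        ring
      · rwa [sup_right_comm]
      · rw [Ideal.ofList_cons, Ideal.ofList_cons, ← sup_assoc, ← sup_assoc, hiff,
          sup_right_comm I]

lemma exists_primes_nonzerodivisorAlong [IsNoetherianRing R] {m : Ideal R} (y : List R) :
    ∀ I : Ideal R, (∀ a ∈ y, a ∈ m) → WeaklyRegularMod I y →
      ∃ S : Set (Ideal R), S.Finite ∧ (∀ p ∈ S, p.IsPrime ∧ ¬ m ≤ p) ∧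
        ∀ w, (∀ p ∈ S, w ∉ p) → NonzerodivisorAlong w I y := by
  induction y with
  | nil => exact fun I _ _ => ⟨∅, Set.finite_empty, by simp, fun _ _ => trivial⟩
  | cons a y ih =>
    intro I hm hreg
    obtain ⟨S, hS, hS1, hS2⟩ := ih _ (fun b hb => hm b (by simp [hb])) hreg.2
    have hass : ∀ w, NonzerodivisorMod I w ↔ ∀ p ∈ associatedPrimes R (R ⧸ I), w ∉ p := by
      intro w
      have h1 := biUnion_associatedPrimes_eq_compl_regular R (R ⧸ I)
      have h2 : w ∈ (⋃ p ∈ associatedPrimes R (R ⧸ I), (p : Set R)) ↔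
          ¬ IsSMulRegular (R ⧸ I) w := by rw [h1]; rfl
      have h3 := isSMulRegular_quotient_iff_mem_of_smul_mem I w
      have h4 : NonzerodivisorMod I w ↔ IsSMulRegular (R ⧸ I) w := by
        rw [h3]; rfl
      rw [h4, ← not_iff_not, ← h2]
      simp
    refine ⟨associatedPrimes R (R ⧸ I) ∪ S, (associatedPrimes.finite R _).union hS, ?_, ?_⟩
    · rintro p (hp | hp)
      · exact ⟨IsAssociatedPrime.isPrime hp,
          fun hle => (hass a).1 hreg.1 p hp (hle (hm a (by simp)))⟩
      · exact hS1 p hp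
    · exact fun w hw => ⟨(hass w).2 fun p hp => hw p (Or.inl hp),
        hS2 w fun p hp => hw p (Or.inr hp)⟩

/-- Whether the socle of the quotient by a regular sequence in `m` is simple
depends only on the length of the sequence. -/
theorem SimpleSocle.of_weaklyRegularMod [IsNoetherianRing R] {m : Ideal R} (k : ℕ) :
    ∀ (I : Ideal R) (y z : List R), y.length = k → z.length = k → (∀ a ∈ y, a ∈ m) →
      (∀ a ∈ z, a ∈ m) → WeaklyRegularMod I y → WeaklyRegularMod I z →
      SimpleSocle m (I ⊔ Ideal.ofList y) → SimpleSocle m (I ⊔ Ideal.ofList z) := by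
  induction k with
  | zero =>
    intro I y z hy hz _ _ _ _
    rw [List.length_eq_zero_iff.1 hy, List.length_eq_zero_iff.1 hz]
    exact id
  | succ k ih =>
    intro I y z hy hz hym hzm hyr hzr
    obtain ⟨S, hS, hS1, hS2⟩ := exists_primes_nonzerodivisorAlong y I hym hyr
    obtain ⟨T, hT, hT1, hT2⟩ := exists_primes_nonzerodivisorAlong z I hzm hzr
    have hprime : ∀ p ∈ S ∪ T, p.IsPrime ∧ ¬ m ≤ p := by
      rintro p (hp | hp)
      exacts [hS1 p hp, hT1 p hp]
    obtain ⟨w, hwm, hw⟩ : ∃ w ∈ m, ∀ p ∈ S ∪ T, w ∉ p := by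
      by_contra! hcon
      have hsub : (m : Set R) ⊆ ⋃ p ∈ S ∪ T, (p : Set R) := by
        intro w hw
        obtain ⟨p, hp, hwp⟩ := hcon w hw
        exact Set.mem_biUnion hp hwp
      obtain ⟨p, hp, hle⟩ := (Ideal.subset_union_prime_finite (f := id) (hS.union hT) ⊥ ⊥
        fun p hp _ _ => (hprime p hp).1).1 hsub
      exact (hprime p hp).2 hle
    obtain ⟨y', hy1, hy2, hy3, hy4⟩ := WeaklyRegularMod.exists_cons hwm y I
      (by rintro rfl; simp at hy) hym hyr (hS2 w fun p hp => hw p (Or.inl hp))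
    obtain ⟨z', hz1, hz2, hz3, hz4⟩ := WeaklyRegularMod.exists_cons hwm z I
      (by rintro rfl; simp at hz) hzm hzr (hT2 w fun p hp => hw p (Or.inr hp))
    rw [hy4, hz4]
    exact ih _ y' z' (by omega) (by omega) hy2 hz2 hy3 hz3

lemma WeaklyRegularMod.of_getElem (l : List R) :
    ∀ I : Ideal R, (∀ (i : ℕ) (h : i < l.length),
      NonzerodivisorMod (I ⊔ Ideal.ofList (l.take i)) l[i]) → WeaklyRegularMod I l := by
  induction l with
  | nil => exact fun _ _ => trivial
  | cons a l ih =>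
    intro I h
    have h0 := h 0 (by simp)
    rw [List.take_zero, Ideal.ofList_nil, sup_bot_eq] at h0
    refine ⟨h0, ih _ fun i hi => ?_⟩
    have hi1 := h (i + 1) (by simpa using hi)
    rwa [List.take_succ_cons, Ideal.ofList_cons, ← sup_assoc] at hi1

lemma WeaklyRegularMod.of_isWeaklyRegular {l : List R}
    (h : RingTheory.Sequence.IsWeaklyRegular R l) : WeaklyRegularMod ⊥ l := by
  refine .of_getElem l ⊥ fun i hi p hp => ?_
  have := (isSMulRegular_quotient_iff_mem_of_smul_mem _ _).1 (h.regular_mod_prev i hi) p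
  simp only [smul_eq_mul, Ideal.mul_top, bot_sup_eq] at this hp ⊢
  exact this hp

end RegularSequences

section Contraction

variable {K : Type} [Field K] {n : ℕ}

lemma commute_pderiv (i j : Fin n) :
    Commute ((pderiv i).toLinearMap : Module.End K (MvPolynomial (Fin n) K))
      (pderiv j).toLinearMap := by
  refine LinearMap.ext fun p => MvPolynomial.ext _ _ fun m => ?_
  change coeff m (pderiv i (pderiv j p)) = coeff m (pderiv j (pderiv i p))
  rcases eq_or_ne i j with rfl | hij
  · rfl
  · simp only [coeff_pderiv, Finsupp.add_apply, Finsupp.single_eq_of_ne hij,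
      Finsupp.single_eq_of_ne hij.symm, add_zero, add_right_comm m]
    ring

lemma monOp_add (d e : Fin n →₀ ℕ) : monOp n K (d + e) = monOp n K d * monOp n K e := by
  unfold monOp
  induction List.finRange n with
  | nil => simp
  | cons i l ih =>
    have hcomm : Commute (((pderiv i).toLinearMap : Module.End K (MvPolynomial (Fin n) K)) ^ e i)
        (l.map fun j =>
          ((pderiv j).toLinearMap : Module.End K (MvPolynomial (Fin n) K)) ^ d j).prod := by
      refine Commute.list_prod_right _ _ fun x hx => ?_
      obtain ⟨j, -, rfl⟩ := List.mem_map.1 hx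
      exact (commute_pderiv i j).pow_pow _ _
    rw [List.map_cons, List.prod_cons, ih, Finsupp.add_apply, pow_add]
    simp only [List.map_cons, List.prod_cons, mul_assoc]
    rw [← mul_assoc (List.prod _) (_ ^ e i), ← hcomm.eq, mul_assoc]

lemma contr_monomial (F : MvPolynomial (Fin n) K) (d : Fin n →₀ ℕ) :
    contr F (monomial d 1) = monOp n K d F := by
  exact (basisMonomials (Fin n) K).constr_basis K (fun d => monOp n K d F) d

lemma contr_monomial_mul (F g : MvPolynomial (Fin n) K) (d : Fin n →₀ ℕ) :
    contr F (monomial d 1 * g) = monOp n K d (contr F g) := by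
  have : contr F ∘ₗ LinearMap.mulLeft K (monomial d 1) = monOp n K d ∘ₗ contr F := by
    refine (basisMonomials (Fin n) K).ext fun e => ?_
    simp [monomial_mul, contr_monomial, monOp_add]
  exact LinearMap.congr_fun this g

/-- The annihilator ideal of `F` under contraction. -/
def contrAnn (F : MvPolynomial (Fin n) K) : Ideal (MvPolynomial (Fin n) K) where
  carrier := {g | contr F g = 0}
  add_mem' := fun {a b} ha hb => by
    simp only [Set.mem_ofPred_eq] at ha hb ⊢
    rw [map_add, ha, hb, add_zero]
  zero_mem' := map_zero _
  smul_mem' := fun p g (hg : contr F g = 0) => by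
    change contr F (p * g) = 0
    induction p using MvPolynomial.induction_on'' with
    | C a => rw [C_mul', map_smul, hg, smul_zero]
    | monomial_add d a f _ _ h1 h2 =>
      rw [add_mul, map_add, h1, h2, add_zero]
    | mul_X p i h =>
      rw [mul_assoc, mul_left_comm, X, contr_monomial_mul, h, map_zero]

@[simp] lemma mem_contrAnn {F g : MvPolynomial (Fin n) K} : g ∈ contrAnn F ↔ contr F g = 0 :=
  Iff.rfl

lemma exists_coeff_pderiv_pow [CharZero K] (i : Fin n) (k : ℕ) (e : Fin n →₀ ℕ) :
    ∃ c : K, c ≠ 0 ∧ ∀ F : MvPolynomial (Fin n) K,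
      coeff e ((((pderiv i).toLinearMap : Module.End K (MvPolynomial (Fin n) K)) ^ k) F) =
        c * coeff (e + Finsupp.single i k) F := by
  induction k with
  | zero => exact ⟨1, one_ne_zero, fun F => by simp⟩
  | succ k ih =>
    obtain ⟨c, hc, h⟩ := ih
    refine ⟨c * (((e + Finsupp.single i k) i : ℕ) + 1 : K),
      mul_ne_zero hc (Nat.cast_add_one_ne_zero _), fun F => ?_⟩
    rw [pow_succ, Module.End.mul_apply, h, Derivation.coeFn_coe, coeff_pderiv, Finsupp.single_add,
      ← add_assoc]
    ring

lemma exists_coeff_list_prod_pderiv [CharZero K] (d : Fin n →₀ ℕ) (l : List (Fin n)) :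
    ∀ e : Fin n →₀ ℕ, ∃ c : K, c ≠ 0 ∧ ∀ F : MvPolynomial (Fin n) K,
      coeff e ((l.map fun i =>
        ((pderiv i).toLinearMap : Module.End K (MvPolynomial (Fin n) K)) ^ d i).prod F) =
        c * coeff (e + (l.map fun i => Finsupp.single i (d i)).sum) F := by
  induction l with
  | nil => exact fun e => ⟨1, one_ne_zero, fun F => by simp⟩
  | cons i l ih =>
    intro e
    obtain ⟨c, hc, h⟩ := exists_coeff_pderiv_pow (K := K) i (d i) e
    obtain ⟨c', hc', h'⟩ := ih (e + Finsupp.single i (d i))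
    refine ⟨c * c', mul_ne_zero hc hc', fun F => ?_⟩
    rw [List.map_cons, List.prod_cons, Module.End.mul_apply, h, h', List.map_cons, List.sum_cons,
      add_assoc, mul_assoc]

lemma contr_monomial_ne_zero [CharZero K] {F : MvPolynomial (Fin n) K} {d : Fin n →₀ ℕ}
    (hd : coeff d F ≠ 0) : contr F (monomial d 1) ≠ 0 := by
  obtain ⟨c, hc, h⟩ := exists_coeff_list_prod_pderiv (K := K) d (List.finRange n) 0
  have hsum : ((List.finRange n).map fun i => Finsupp.single i (d i)).sum = d := by
    rw [← List.ofFn_eq_map, List.sum_ofFn, Finsupp.univ_sum_single]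
  rw [contr_monomial]
  intro h0
  have := h F
  rw [zero_add, hsum, ← monOp, h0, coeff_zero] at this
  exact mul_ne_zero hc hd this.symm

end Contraction

section HilbertFunction

variable {K : Type} [Field K] {n : ℕ}

instance finite_homogeneousSubmodule (i : ℕ) :
    Module.Finite K (homogeneousSubmodule (Fin n) K i) := by
  refine Module.Finite.of_injective
    (Submodule.inclusion (fun p hp => ?_ : homogeneousSubmodule (Fin n) K i ≤
      restrictTotalDegree (Fin n) K i)) (Submodule.inclusion_injective _)
  rw [mem_restrictTotalDegree]
  exact IsHomogeneous.totalDegree_le hp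

/-- The degree `i` part of an ideal of the polynomial ring. -/
noncomputable def idealPart (I : Ideal (MvPolynomial (Fin n) K)) (i : ℕ) :
    Submodule K (MvPolynomial (Fin n) K) :=
  I.restrictScalars K ⊓ homogeneousSubmodule (Fin n) K i

lemma mem_idealPart {I : Ideal (MvPolynomial (Fin n) K)} {i : ℕ} {p : MvPolynomial (Fin n) K} :
    p ∈ idealPart I i ↔ p ∈ I ∧ p.IsHomogeneous i := Iff.rfl

instance (I : Ideal (MvPolynomial (Fin n) K)) (i : ℕ) : Module.Finite K (idealPart I i) :=
  Submodule.finiteDimensional_of_le (inf_le_right : idealPart I i ≤ _)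

/-- The Hilbert function of the quotient by `I`. -/
noncomputable def quotHilbert (I : Ideal (MvPolynomial (Fin n) K)) (i : ℕ) : ℤ :=
  Module.finrank K (homogeneousSubmodule (Fin n) K i) - Module.finrank K (idealPart I i)

lemma quotHilbert_eq_zero_iff {I : Ideal (MvPolynomial (Fin n) K)} {i : ℕ} :
    quotHilbert I i = 0 ↔ ∀ p : MvPolynomial (Fin n) K, p.IsHomogeneous i → p ∈ I := by
  have hle : idealPart I i ≤ homogeneousSubmodule (Fin n) K i := inf_le_right
  rw [quotHilbert, sub_eq_zero, Nat.cast_inj]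
  constructor
  · intro h p hp
    have := Submodule.eq_of_le_of_finrank_eq hle h.symm
    have hp' : p ∈ idealPart I i := this ▸ hp
    exact hp'.1
  · intro h
    rw [le_antisymm hle fun p hp => ⟨h p hp, hp⟩]

/-- Closure of an ideal under taking homogeneous components. -/
def ClosedUnderComponents (I : Ideal (MvPolynomial (Fin n) K)) : Prop :=
  ∀ p ∈ I, ∀ i, homogeneousComponent i p ∈ I

lemma homogeneousComponent_mul {f : MvPolynomial (Fin n) K} {d : ℕ} (hf : f.IsHomogeneous d)
    (q : MvPolynomial (Fin n) K) (i : ℕ) :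
    homogeneousComponent i (f * q) =
      if d ≤ i then f * homogeneousComponent (i - d) q else 0 := by
  let := gradedAlgebra (σ := Fin n) (R := K)
  have := DirectSum.coe_decompose_mul_of_left_mem (homogeneousSubmodule (Fin n) K) (b := q) i
    (a := f) hf
  rw [← decomposition.decompose'_apply, ← decomposition.decompose'_apply]
  exact this

lemma ClosedUnderComponents.sup_span {I : Ideal (MvPolynomial (Fin n) K)}
    (hI : ClosedUnderComponents I) {f : MvPolynomial (Fin n) K} {d : ℕ} (hf : f.IsHomogeneous d) :
    ClosedUnderComponents (I ⊔ Ideal.span {f}) := by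
  intro p hp i
  obtain ⟨k, hk⟩ := mem_sup_span_singleton.1 hp
  have := hI _ hk i
  rw [map_sub, homogeneousComponent_mul hf] at this
  split_ifs at this with h
  · exact mem_sup_span_singleton.2 ⟨_, this⟩
  · exact Ideal.mem_sup_left (by simpa using this)

lemma exists_of_mem_idealPart_sup {I : Ideal (MvPolynomial (Fin n) K)}
    (hI : ClosedUnderComponents I) {f : MvPolynomial (Fin n) K} {d : ℕ} (hf : f.IsHomogeneous d)
    {i : ℕ} {p : MvPolynomial (Fin n) K} (hp : p ∈ idealPart (I ⊔ Ideal.span {f}) i) :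
    ∃ k : MvPolynomial (Fin n) K,
      p - (if d ≤ i then f * homogeneousComponent (i - d) k else 0) ∈ I := by
  obtain ⟨k, hk⟩ := mem_sup_span_singleton.1 hp.1
  have := hI _ hk i
  rw [map_sub, homogeneousComponent_mul hf, homogeneousComponent_of_mem hp.2, if_pos rfl] at this
  exact ⟨k, this⟩

lemma idealPart_sup_span_of_lt {I : Ideal (MvPolynomial (Fin n) K)}
    (hI : ClosedUnderComponents I) {f : MvPolynomial (Fin n) K} {d : ℕ} (hf : f.IsHomogeneous d)
    {i : ℕ} (hi : i < d) : idealPart (I ⊔ Ideal.span {f}) i = idealPart I i := by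
  refine le_antisymm (fun p hp => ?_) fun p hp => ⟨Ideal.mem_sup_left hp.1, hp.2⟩
  obtain ⟨k, hk⟩ := exists_of_mem_idealPart_sup hI hf hp
  rw [if_neg (by omega), sub_zero] at hk
  exact ⟨hk, hp.2⟩

lemma idealPart_sup_span_add {I : Ideal (MvPolynomial (Fin n) K)}
    (hI : ClosedUnderComponents I) {f : MvPolynomial (Fin n) K} {d : ℕ} (hf : f.IsHomogeneous d)
    (i : ℕ) : idealPart (I ⊔ Ideal.span {f}) (i + d) = idealPart I (i + d) ⊔
      (homogeneousSubmodule (Fin n) K i).map (LinearMap.mulLeft K f) := by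
  apply le_antisymm
  · intro p hp
    obtain ⟨k, hk⟩ := exists_of_mem_idealPart_sup hI hf hp
    rw [if_pos (by omega), Nat.add_sub_cancel] at hk
    have hhom : (f * homogeneousComponent i k).IsHomogeneous (i + d) := by
      rw [add_comm]; exact hf.mul (homogeneousComponent_isHomogeneous i k)
    exact Submodule.mem_sup.2 ⟨_, ⟨hk, Submodule.sub_mem _ hp.2 hhom⟩, _,
      Submodule.mem_map_of_mem (homogeneousComponent_mem i k), by simp⟩
  · refine sup_le (fun p hp => ⟨Ideal.mem_sup_left hp.1, hp.2⟩) ?_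
    rintro _ ⟨q, hq, rfl⟩
    refine ⟨Ideal.mem_sup_right (Ideal.mem_span_singleton.2 (dvd_mul_right f q)), ?_⟩
    rw [add_comm]
    exact hf.mul hq

lemma idealPart_inf_map_mulLeft {I : Ideal (MvPolynomial (Fin n) K)}
    {f : MvPolynomial (Fin n) K} {d : ℕ} (hf : f.IsHomogeneous d) (hreg : NonzerodivisorMod I f)
    (i : ℕ) : idealPart I (i + d) ⊓
      (homogeneousSubmodule (Fin n) K i).map (LinearMap.mulLeft K f) =
        (idealPart I i).map (LinearMap.mulLeft K f) := by
  apply le_antisymm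
  · rintro _ ⟨hp, q, hq, rfl⟩
    exact ⟨q, ⟨hreg q hp.1, hq⟩, rfl⟩
  · rintro _ ⟨q, hq, rfl⟩
    refine ⟨⟨I.mul_mem_left f hq.1, ?_⟩, q, hq.2, rfl⟩
    change (f * q).IsHomogeneous (i + d)
    rw [add_comm]
    exact hf.mul hq.2

lemma quotHilbert_sup_span {I : Ideal (MvPolynomial (Fin n) K)}
    (hI : ClosedUnderComponents I) {f : MvPolynomial (Fin n) K} {d : ℕ} (hf : f.IsHomogeneous d)
    (hreg : NonzerodivisorMod I f) (i : ℕ) :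
    quotHilbert (I ⊔ Ideal.span {f}) i =
      quotHilbert I i - if d ≤ i then quotHilbert I (i - d) else 0 := by
  split_ifs with hi
  · by_cases hf0 : f = 0
    · have hI' : ∀ p, p ∈ I := fun p => hreg p (by rw [hf0, zero_mul]; exact I.zero_mem)
      rw [quotHilbert_eq_zero_iff.2 fun p _ => hI' p,
        quotHilbert_eq_zero_iff.2 fun p _ => hI' p,
        quotHilbert_eq_zero_iff.2 fun p _ => Ideal.mem_sup_left (hI' p), sub_zero]
    · obtain ⟨j, rfl⟩ := Nat.exists_eq_add_of_le' hi
      have hinj : Function.Injective (LinearMap.mulLeft K f) := fun a b h =>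
        mul_left_cancel₀ hf0 h
      have hdim := Submodule.finrank_sup_add_finrank_inf_eq (idealPart I (j + d))
        ((homogeneousSubmodule (Fin n) K j).map (LinearMap.mulLeft K f))
      rw [← idealPart_sup_span_add hI hf, idealPart_inf_map_mulLeft hf hreg,
        ← (Submodule.equivMapOfInjective _ hinj _).finrank_eq,
        ← (Submodule.equivMapOfInjective _ hinj _).finrank_eq] at hdim
      rw [Nat.add_sub_cancel, quotHilbert, quotHilbert, quotHilbert]
      omega
  · rw [quotHilbert, idealPart_sup_span_of_lt hI hf (by omega), sub_zero, quotHilbert]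

lemma mk_quotHilbert_sup_ofList {d : ℕ} (l : List (MvPolynomial (Fin n) K)) :
    ∀ I : Ideal (MvPolynomial (Fin n) K), ClosedUnderComponents I →
      (∀ f ∈ l, f.IsHomogeneous d) → WeaklyRegularMod I l →
      PowerSeries.mk (quotHilbert (I ⊔ Ideal.ofList l)) =
        (1 - PowerSeries.X ^ d) ^ l.length * PowerSeries.mk (quotHilbert I) := by
  induction l with
  | nil => intro I _ _ _; simp
  | cons f l ih =>
    intro I hI hl hreg
    have hf : f.IsHomogeneous d := hl f (by simp)
    have hstep : PowerSeries.mk (quotHilbert (I ⊔ Ideal.span {f})) =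
        (1 - PowerSeries.X ^ d) * PowerSeries.mk (quotHilbert I) := by
      ext i
      rw [sub_mul, one_mul, map_sub, PowerSeries.coeff_X_pow_mul', PowerSeries.coeff_mk,
        PowerSeries.coeff_mk, PowerSeries.coeff_mk, quotHilbert_sup_span hI hf hreg.1]
    rw [Ideal.ofList_cons, ← sup_assoc,
      ih _ (hI.sup_span hf) (fun g hg => hl g (by simp [hg])) hreg.2, hstep, List.length_cons,
      pow_succ, mul_assoc]

lemma ofList_take_ofFn_X (i : ℕ) :
    Ideal.ofList ((List.ofFn fun j : Fin n => (X j : MvPolynomial (Fin n) K)).take i) =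
      Ideal.span (X '' {j : Fin n | (j : ℕ) < i}) := by
  refine congrArg Ideal.span (Set.ext fun p => ?_)
  simp only [Set.mem_ofPred_eq, List.mem_take_iff_getElem, List.length_ofFn, List.getElem_ofFn,
    Set.mem_image]
  constructor
  · rintro ⟨j, hj, rfl⟩
    exact ⟨⟨j, by omega⟩, by simp; omega, rfl⟩
  · rintro ⟨j, hj, rfl⟩
    exact ⟨j, by simp [hj], rfl⟩

lemma ofList_ofFn_X :
    Ideal.ofList (List.ofFn fun j : Fin n => (X j : MvPolynomial (Fin n) K)) =
      Ideal.span (X '' Set.univ) := by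
  have := ofList_take_ofFn_X (K := K) (n := n) n
  rw [List.take_of_length_le (by simp)] at this
  rw [this]
  congr 2
  ext j
  simp

lemma weaklyRegularMod_ofFn_X :
    WeaklyRegularMod ⊥ (List.ofFn fun j : Fin n => (X j : MvPolynomial (Fin n) K)) := by
  refine .of_getElem _ ⊥ fun i hi p hp => ?_
  rw [bot_sup_eq, ofList_take_ofFn_X, mem_ideal_span_X_image] at hp ⊢
  intro m hm
  rw [List.getElem_ofFn] at hp
  have hin : i < n := by simpa using hi
  obtain ⟨j, hj, hne⟩ := hp (Finsupp.single ⟨i, hin⟩ 1 + m) (by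
    rw [mem_support_iff, coeff_X_mul]
    exact mem_support_iff.1 hm)
  refine ⟨j, hj, ?_⟩
  have hj' : (j : ℕ) < i := hj
  have hji : j ≠ ⟨i, hin⟩ := by
    rintro rfl
    simp at hj'
  simpa [Finsupp.single_eq_of_ne hji] using hne

lemma mem_span_X_of_isHomogeneous {p : MvPolynomial (Fin n) K} {i : ℕ} (hi : i ≠ 0)
    (hp : p.IsHomogeneous i) :
    p ∈ Ideal.ofList (List.ofFn fun j : Fin n => (X j : MvPolynomial (Fin n) K)) := by
  rw [ofList_ofFn_X, mem_ideal_span_X_image]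
  intro m hm
  by_contra! hcon
  have hm0 : m = 0 := Finsupp.ext fun j => by simpa using hcon j
  refine hi ?_
  rw [← hp (mem_support_iff.1 hm), hm0, map_zero]

lemma closedUnderComponents_bot :
    ClosedUnderComponents (⊥ : Ideal (MvPolynomial (Fin n) K)) := by
  intro p hp i
  rw [Ideal.mem_bot] at hp
  simp [hp]

/-- Forms of degree greater than `n` lie in the ideal of any regular sequence of `n` quadrics. -/
theorem mem_ofList_of_isHomogeneous {l : List (MvPolynomial (Fin n) K)} (hl : l.length = n)
    (hquad : ∀ f ∈ l, f.IsHomogeneous 2) (hreg : WeaklyRegularMod ⊥ l)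
    {p : MvPolynomial (Fin n) K} {i : ℕ} (hi : n < i) (hp : p.IsHomogeneous i) :
    p ∈ Ideal.ofList l := by
  have hq := mk_quotHilbert_sup_ofList l ⊥ closedUnderComponents_bot hquad hreg
  have hx := mk_quotHilbert_sup_ofList (d := 1) _ ⊥ closedUnderComponents_bot
    (fun f hf => by
      obtain ⟨j, rfl⟩ := (List.mem_ofFn' _ _).1 hf
      exact isHomogeneous_X K j) (weaklyRegularMod_ofFn_X (K := K) (n := n))
  rw [bot_sup_eq] at hq hx
  have hconst : PowerSeries.mk (quotHilbert (Ideal.ofList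
      (List.ofFn fun j : Fin n => (X j : MvPolynomial (Fin n) K)))) =
        PowerSeries.C (quotHilbert (Ideal.ofList
          (List.ofFn fun j : Fin n => (X j : MvPolynomial (Fin n) K))) 0) := by
    ext k
    rw [PowerSeries.coeff_mk, PowerSeries.coeff_C]
    split_ifs with hk
    · rw [hk]
    · exact quotHilbert_eq_zero_iff.2 fun p hp => mem_span_X_of_isHomogeneous hk hp
  rw [hconst, List.length_ofFn, pow_one] at hx
  have hpoly : PowerSeries.mk (quotHilbert (Ideal.ofList l)) =
      (((1 + Polynomial.X) ^ n * Polynomial.C (quotHilbert (Ideal.ofList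
        (List.ofFn fun j : Fin n => (X j : MvPolynomial (Fin n) K))) 0) : Polynomial ℤ) :
          PowerSeries ℤ) := by
    push_cast
    rw [hq, hx, hl, ← mul_assoc, ← mul_pow]
    congr 2
    ring
  have hdeg : ((1 + Polynomial.X) ^ n * Polynomial.C (quotHilbert (Ideal.ofList
      (List.ofFn fun j : Fin n => (X j : MvPolynomial (Fin n) K))) 0) :
        Polynomial ℤ).natDegree < i := by
    refine lt_of_le_of_lt (by compute_degree) hi
  have hzero := congrArg (PowerSeries.coeff i) hpoly
  rw [PowerSeries.coeff_mk, Polynomial.coeff_coe,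
    Polynomial.coeff_eq_zero_of_natDegree_lt hdeg] at hzero
  exact quotHilbert_eq_zero_iff.1 hzero p hp

end HilbertFunction

section Main

variable {K : Type} [Field K] {n : ℕ}

lemma ofList_ofFn (f : Fin n → MvPolynomial (Fin n) K) :
    Ideal.ofList (List.ofFn f) = Ideal.span (Set.range f) :=
  congrArg Ideal.span (Set.ext fun p => by simp [List.mem_ofFn])

lemma mem_span_X_iff {p : MvPolynomial (Fin n) K} :
    p ∈ Ideal.ofList (List.ofFn fun j : Fin n => (X j : MvPolynomial (Fin n) K)) ↔
      coeff 0 p = 0 := by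
  rw [ofList_ofFn_X, mem_ideal_span_X_image]
  constructor
  · intro h
    by_contra h0
    obtain ⟨i, -, hi⟩ := h 0 (mem_support_iff.2 h0)
    simp at hi
  · intro h m hm
    by_contra! hcon
    have hm0 : m = 0 := Finsupp.ext fun j => by simpa using hcon j
    exact mem_support_iff.1 hm (hm0 ▸ h)

lemma simpleSocle_span_X :
    SimpleSocle (Ideal.ofList (List.ofFn fun j : Fin n => (X j : MvPolynomial (Fin n) K)))
      (Ideal.ofList (List.ofFn fun j : Fin n => (X j : MvPolynomial (Fin n) K))) := by
  intro g h _ _ hg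
  rw [mem_span_X_iff] at hg
  refine ⟨C (coeff 0 h / coeff 0 g), mem_span_X_iff.2 ?_⟩
  rw [coeff_sub, coeff_C_mul, div_mul_cancel₀ _ hg, sub_self]

/-- If all forms of large degree lie in `J`, every `g ∉ J` has a multiple
that is nonzero in the socle of the quotient by `J`. -/
lemma exists_mul_mem_socle {J : Ideal (MvPolynomial (Fin n) K)} {N : ℕ}
    (hJ : ∀ i, N < i → ∀ p : MvPolynomial (Fin n) K, p.IsHomogeneous i → p ∈ J)
    {g : MvPolynomial (Fin n) K} (hg : g ∉ J) :
    ∃ q, q * g ∉ J ∧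
      ∀ x ∈ Ideal.ofList (List.ofFn fun j : Fin n => (X j : MvPolynomial (Fin n) K)),
        x * (q * g) ∈ J := by
  classical
  let P : ℕ → Prop := fun k => ∃ q : MvPolynomial (Fin n) K, q.IsHomogeneous k ∧ q * g ∉ J
  have hP0 : P 0 := ⟨1, isHomogeneous_one _ _, by rwa [one_mul]⟩
  obtain ⟨q, hq, hqg⟩ : P (Nat.findGreatest P N) := Nat.findGreatest_spec (Nat.zero_le N) hP0
  refine ⟨q, hqg, fun x hx => ?_⟩
  have hle : Ideal.ofList (List.ofFn fun j : Fin n => (X j : MvPolynomial (Fin n) K)) ≤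
      J.colon {q * g} := by
    refine Ideal.span_le.2 fun y hy => ?_
    obtain ⟨j, rfl⟩ := (List.mem_ofFn' _ _).1 hy
    refine Submodule.mem_colon_singleton.2 ?_
    by_contra hcon
    have hhom : (X j * q).IsHomogeneous (1 + Nat.findGreatest P N) := (isHomogeneous_X K j).mul hq
    have hPs : P (1 + Nat.findGreatest P N) := ⟨X j * q, hhom, by rwa [mul_assoc]⟩
    by_cases hN : 1 + Nat.findGreatest P N ≤ N
    · have := Nat.le_findGreatest hN hPs
      omega
    · refine hcon ?_
      rw [smul_eq_mul, ← mul_assoc]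
      exact J.mul_mem_right _ (hJ _ (by omega) _ hhom)
  exact Submodule.mem_colon_singleton.1 (hle hx)

/-- The annihilator of a nonzero form of degree `n` equals any ideal it contains that is
generated by a regular sequence of `n` quadrics. -/
theorem contrAnn_eq_ofList [CharZero K] {F : MvPolynomial (Fin n) K} (hF : F ≠ 0)
    (hhom : F.IsHomogeneous n) {l : List (MvPolynomial (Fin n) K)} (hl : l.length = n)
    (hquad : ∀ f ∈ l, f.IsHomogeneous 2) (hreg : WeaklyRegularMod ⊥ l)
    (hann : Ideal.ofList l ≤ contrAnn F) : contrAnn F = Ideal.ofList l := by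
  refine le_antisymm (fun g hg => ?_) hann
  by_contra hgJ
  have hbig : ∀ i, n < i → ∀ p : MvPolynomial (Fin n) K, p.IsHomogeneous i →
      p ∈ Ideal.ofList l := fun i hi p hp => mem_ofList_of_isHomogeneous hl hquad hreg hi hp
  obtain ⟨q, hq, hqm⟩ := exists_mul_mem_socle hbig hgJ
  obtain ⟨d, hd⟩ := ne_zero_iff.1 hF
  have hsocle : SimpleSocle
      (Ideal.ofList (List.ofFn fun j : Fin n => (X j : MvPolynomial (Fin n) K)))
      (Ideal.ofList l) := by
    have := SimpleSocle.of_weaklyRegularMod n ⊥ _ l List.length_ofFn hl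
      (fun a ha => Ideal.subset_span ha)
      (fun f hf => mem_span_X_of_isHomogeneous two_ne_zero (hquad f hf))
      (weaklyRegularMod_ofFn_X (K := K)) hreg
    simp only [bot_sup_eq] at this
    exact this simpleSocle_span_X
  have hdeg : (monomial d (1 : K)).IsHomogeneous n := by
    have hdn := hhom hd
    refine isHomogeneous_monomial 1 ?_
    rw [Finsupp.degree_eq_weight_one]
    exact hdn
  have hmon : ∀ x ∈ Ideal.ofList (List.ofFn fun j : Fin n => (X j : MvPolynomial (Fin n) K)),
      x * monomial d (1 : K) ∈ Ideal.ofList l := by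
    intro x hx
    have hle : Ideal.ofList (List.ofFn fun j : Fin n => (X j : MvPolynomial (Fin n) K)) ≤
        (Ideal.ofList l).colon {monomial d (1 : K)} := by
      refine Ideal.span_le.2 fun y hy => ?_
      obtain ⟨j, rfl⟩ := (List.mem_ofFn' _ _).1 hy
      exact Submodule.mem_colon_singleton.2
        (hbig _ (by omega) _ ((isHomogeneous_X K j).mul hdeg : IsHomogeneous _ (1 + n)))
    exact Submodule.mem_colon_singleton.1 (hle hx)
  obtain ⟨r, hr⟩ := hsocle _ _ hqm hmon hq
  refine contr_monomial_ne_zero hd (mem_contrAnn.1 ?_)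
  have := (contrAnn F).add_mem (hann hr)
    ((contrAnn F).mul_mem_left r ((contrAnn F).mul_mem_left q hg))
  rwa [sub_add_cancel] at this

end Main

/-- For `F` homogeneous of degree `n` with linearly independent
partial derivatives, `Ann_R(F)` is generated by a regular sequence of `n`
homogeneous quadratic forms (`A(F)` is a quadratic complete intersection) iff
the quadratic space `Q(F) = Ann_R(F)_2` contains a regular sequence of length
`n` in `R`. -/
theorem quadratic_ci_iff_regular_sequence_in_quadratic_space
    {K : Type} [Field K] [CharZero K] {n : ℕ}
    (F : MvPolynomial (Fin n) K) (hF : F ≠ 0) (hhom : F.IsHomogeneous n)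
    (hind : LinearIndependent K fun i : Fin n => pderiv i F) :
    (∃ f : Fin n → MvPolynomial (Fin n) K,
        (∀ i, (f i).IsHomogeneous 2) ∧
        RingTheory.Sequence.IsRegular (MvPolynomial (Fin n) K) (List.ofFn f) ∧
        {g : MvPolynomial (Fin n) K | contr F g = 0} = ↑(Ideal.span (Set.range f)))
    ↔ (∃ f : Fin n → MvPolynomial (Fin n) K,
        (∀ i, (f i).IsHomogeneous 2 ∧ contr F (f i) = 0) ∧
        RingTheory.Sequence.IsRegular (MvPolynomial (Fin n) K) (List.ofFn f)) := by
  constructor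
  · rintro ⟨f, hf, hreg, hann⟩
    refine ⟨f, fun i => ⟨hf i, ?_⟩, hreg⟩
    have hi : f i ∈ (Ideal.span (Set.range f) : Set (MvPolynomial (Fin n) K)) :=
      Ideal.subset_span (Set.mem_range_self i)
    rwa [← hann] at hi
  · rintro ⟨f, hf, hreg⟩
    refine ⟨f, fun i => (hf i).1, hreg, ?_⟩
    have hspan : Ideal.ofList (List.ofFn f) ≤ contrAnn F := by
      rw [ofList_ofFn]
      exact Ideal.span_le.2 (Set.range_subset_iff.2 fun i => (hf i).2)
    have hquad : ∀ g ∈ List.ofFn f, g.IsHomogeneous 2 := by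
      intro g hg
      obtain ⟨i, rfl⟩ := (List.mem_ofFn' _ _).1 hg
      exact (hf i).1
    rw [← ofList_ofFn, ← contrAnn_eq_ofList hF hhom List.length_ofFn hquad
      (.of_isWeaklyRegular hreg.toIsWeaklyRegular) hspan]
    rfl
end

section
/- Let K be a field of characteristic zero, R = K[v,w,x,y,z], and F = vwxyz + xyz³. Then Ann_R(F) is equal to the ideal (v², w², x², y², z² − 6vw), and these five quadratic forms form a regular sequence in R; hence A(F) is a quadratic complete intersection. -/
open MvPolynomial

open Finsupp in
theorem MvPolynomial.coeff_pderiv_pow {σ R : Type*} [CommSemiring R] (i : σ) (k : ℕ)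
    (p : MvPolynomial σ R) (m : σ →₀ ℕ) :
    coeff m (((pderiv i).toLinearMap ^ k : Module.End R (MvPolynomial σ R)) p) =
      coeff (m + single i k) p * ((m i + 1).ascFactorial k : R) := by
  induction k generalizing p with
  | zero => simp
  | succ k ih =>
    rw [pow_succ, Module.End.mul_apply, ih,
      show ⇑(pderiv i).toLinearMap = ⇑(pderiv (R := R) i) from rfl,
      coeff_pderiv, add_assoc, ← single_add, Nat.ascFactorial_succ]
    simp only [Finsupp.add_apply, single_eq_same]
    push_cast
    ring

open Finsupp in
theorem coeff_list_prod_pderiv_pow {σ R : Type*} [CommSemiring R] (d : σ →₀ ℕ) {l : List σ}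
    (hl : l.Nodup) (p : MvPolynomial σ R) (m : σ →₀ ℕ) :
    coeff m ((l.map fun i =>
        ((pderiv i).toLinearMap : Module.End R (MvPolynomial σ R)) ^ d i).prod p) =
      coeff (m + (l.map fun i => single i (d i)).sum) p *
        ((l.map fun i => (m i + 1).ascFactorial (d i)).prod : ℕ) := by
  induction l generalizing m with
  | nil => simp
  | cons a l ih =>
    obtain ⟨ha, hl⟩ := List.nodup_cons.mp hl
    have key : (l.map fun i => ((m + single a (d a)) i + 1).ascFactorial (d i)) =
        l.map fun i => (m i + 1).ascFactorial (d i) :=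
      List.map_congr_left fun i hi => by
        simp [single_eq_of_ne (show i ≠ a from fun h => ha (h ▸ hi))]
    rw [List.map_cons, List.prod_cons, Module.End.mul_apply, coeff_pderiv_pow, ih hl, key,
      List.map_cons, List.sum_cons, List.map_cons, List.prod_cons, add_assoc]
    push_cast
    ring

theorem coeff_monOp {K : Type} [Field K] {n : ℕ} (d m : Fin n →₀ ℕ)
    (p : MvPolynomial (Fin n) K) :
    coeff m (monOp n K d p) =
      coeff (m + d) p * ((∏ i, (m i + 1).ascFactorial (d i) : ℕ) : K) := by
  have hd : ((List.finRange n).map fun i => Finsupp.single i (d i)).sum = d := by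
    rw [← List.ofFn_eq_map, List.sum_ofFn, Finsupp.univ_sum_single]
  rw [monOp, coeff_list_prod_pderiv_pow d (List.nodup_finRange n), hd, ← List.ofFn_eq_map,
    List.prod_ofFn]

theorem contr_add {K : Type} [Field K] {n : ℕ} (F G f : MvPolynomial (Fin n) K) :
    contr (F + G) f = contr F f + contr G f := by
  suffices contr (F + G) = contr F + contr G by rw [this, LinearMap.add_apply]
  refine (basisMonomials (Fin n) K).ext fun d => ?_
  simp [contr, Module.Basis.constr_basis, -coe_basisMonomials]

theorem coeff_contr_monomial {K : Type} [Field K] {n : ℕ} (e m : Fin n →₀ ℕ) (a : K)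
    (f : MvPolynomial (Fin n) K) :
    ((∏ i, (m i).factorial : ℕ) : K) * coeff m (contr (monomial e a) f) =
      ((∏ i, (e i).factorial : ℕ) : K) * a * coeff e (monomial m 1 * f) := by
  classical
  induction f using MvPolynomial.induction_on' with
  | add p q hp hq => simp only [map_add, coeff_add, mul_add, hp, hq]
  | monomial d c =>
    have hc : contr (monomial e a) (monomial d c) = c • monOp n K d (monomial e a) := by
      have h : (monomial d c : MvPolynomial (Fin n) K) = c • basisMonomials (Fin n) K d := by
        simp [smul_monomial]
      rw [h, map_smul, contr, Module.Basis.constr_basis]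
    rw [hc, coeff_smul, coeff_monOp, monomial_mul, coeff_monomial, coeff_monomial, one_mul]
    by_cases h : e = m + d
    · subst h
      simp only [if_true, smul_eq_mul, Finsupp.add_apply, ← Nat.factorial_mul_ascFactorial,
        Finset.prod_mul_distrib, Nat.cast_mul]
      ring
    · simp [h, Ne.symm h]

theorem contr_monomial_add_monomial_eq_zero_iff {K : Type} [Field K] [CharZero K] {n : ℕ}
    (d e : Fin n →₀ ℕ) (a b : K) (f : MvPolynomial (Fin n) K) :
    contr (monomial d a + monomial e b) f = 0 ↔
      ∀ m, ((∏ i, (d i).factorial : ℕ) : K) * a * coeff d (monomial m 1 * f) +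
        ((∏ i, (e i).factorial : ℕ) : K) * b * coeff e (monomial m 1 * f) = 0 := by
  rw [MvPolynomial.ext_iff]
  refine forall_congr' fun m => ?_
  have hm : ((∏ i, (m i).factorial : ℕ) : K) ≠ 0 :=
    Nat.cast_ne_zero.mpr (Finset.prod_ne_zero_iff.mpr fun i _ => (m i).factorial_ne_zero)
  rw [← coeff_contr_monomial, ← coeff_contr_monomial, ← mul_add, ← coeff_add, ← contr_add,
    coeff_zero, mul_eq_zero, or_iff_right hm]

theorem mem_span_X_sq_image {σ R : Type*} [CommSemiring R] (s : Set σ) (f : MvPolynomial σ R) :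
    f ∈ Ideal.span ((fun i => (X i : MvPolynomial σ R) ^ 2) '' s) ↔
      ∀ m ∈ f.support, ∃ i ∈ s, 2 ≤ m i := by
  have h : (fun i => (X i : MvPolynomial σ R) ^ 2) '' s =
      (fun m => monomial m (1 : R)) '' ((fun i => Finsupp.single i 2) '' s) := by
    simp [Set.image_image, X_pow_eq_monomial]
  rw [h, mem_ideal_span_monomial_image]
  simp [Finsupp.single_le_iff]

theorem mem_span_X_sq_image_of_X_pow_mul_mem {σ R : Type*} [CommSemiring R] {s : Set σ} {i : σ}
    (hi : i ∉ s) (k : ℕ) {f : MvPolynomial σ R}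
    (hf : X i ^ k * f ∈ Ideal.span ((fun i => (X i : MvPolynomial σ R) ^ 2) '' s)) :
    f ∈ Ideal.span ((fun i => (X i : MvPolynomial σ R) ^ 2) '' s) := by
  rw [mem_span_X_sq_image] at hf ⊢
  intro m hm
  obtain ⟨j, hj, h⟩ := hf (Finsupp.single i k + m) (by
    rwa [mem_support_iff, X_pow_eq_monomial, coeff_monomial_mul, one_mul, ← mem_support_iff])
  refine ⟨j, hj, ?_⟩
  rwa [Finsupp.add_apply, Finsupp.single_eq_of_ne (show j ≠ i from fun e => hi (e ▸ hj)),
    zero_add] at h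

theorem isSMulRegular_quotient_span_X_sq_image {σ R : Type*} [CommRing R] {s : Set σ} {i : σ}
    (hi : i ∉ s) (k : ℕ) :
    IsSMulRegular (MvPolynomial σ R ⧸ Ideal.span ((fun i => (X i : MvPolynomial σ R) ^ 2) '' s))
      (X i ^ k : MvPolynomial σ R) :=
  (isSMulRegular_quotient_iff_mem_of_smul_mem _ _).mpr fun _ =>
    mem_span_X_sq_image_of_X_pow_mul_mem hi k

/-- The exponent vector of `vwxyz`. -/
noncomputable abbrev expVWXYZ : Fin 5 →₀ ℕ := Finsupp.equivFunOnFinite.symm ![1, 1, 1, 1, 1]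

/-- The exponent vector of `xyz³`. -/
noncomputable abbrev expXYZCubed : Fin 5 →₀ ℕ := Finsupp.equivFunOnFinite.symm ![0, 0, 1, 1, 3]

/-- The ideal `(v², w², x², y², z² − 6vw)`. -/
noncomputable abbrev quadricIdeal (K : Type) [Field K] : Ideal (MvPolynomial (Fin 5) K) :=
  Ideal.span {(X 0) ^ 2, (X 1) ^ 2, (X 2) ^ 2, (X 3) ^ 2, (X 4) ^ 2 - 6 * (X 0 * X 1)}

theorem vwxyz_add_xyz_cubed_eq (K : Type) [Field K] :
    (X 0 : MvPolynomial (Fin 5) K) * X 1 * X 2 * X 3 * X 4 + X 2 * X 3 * (X 4) ^ 3 =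
      monomial expVWXYZ 1 + monomial expXYZCubed 1 := by
  simp [monomial_eq, Finsupp.prod_fintype, Fin.prod_univ_five]

theorem contr_vwxyz_add_xyz_cubed_eq_zero_iff {K : Type} [Field K] [CharZero K]
    (f : MvPolynomial (Fin 5) K) :
    contr ((X 0 : MvPolynomial (Fin 5) K) * X 1 * X 2 * X 3 * X 4 + X 2 * X 3 * (X 4) ^ 3) f = 0 ↔
      ∀ m, coeff expVWXYZ (monomial m 1 * f) + 6 * coeff expXYZCubed (monomial m 1 * f) = 0 := by
  rw [vwxyz_add_xyz_cubed_eq, contr_monomial_add_monomial_eq_zero_iff]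
  simp [Fin.prod_univ_five, Nat.factorial]

theorem monomial_mul_sq_sub_six_mul {K : Type} [Field K] (m : Fin 5 →₀ ℕ) (c : K) :
    monomial m c * ((X 4) ^ 2 - 6 * (X 0 * X 1)) = monomial (m + Finsupp.single 4 2) c -
      monomial (m + Finsupp.single 0 1 + Finsupp.single 1 1) (6 * c) := by
  have h : monomial (m + Finsupp.single 0 1 + Finsupp.single 1 1) (6 * c) =
      6 * monomial m c * X 0 * X 1 := by
    rw [show (6 : MvPolynomial (Fin 5) K) = C 6 from rfl, C_mul_monomial, X, X, monomial_mul,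
      monomial_mul, mul_one, mul_one]
  have h' : monomial (m + Finsupp.single 4 2) c = monomial m c * (X 4) ^ 2 := by
    rw [X_pow_eq_monomial, monomial_mul, mul_one]
  rw [h, h']
  ring

theorem coeff_add_six_mul_coeff_eq_zero_of_mem {K : Type} [Field K] {f : MvPolynomial (Fin 5) K}
    (hf : f ∈ quadricIdeal K) : coeff expVWXYZ f + 6 * coeff expXYZCubed f = 0 := by
  induction hf using Submodule.closure_induction with
  | zero => simp
  | add p q _ _ hp hq =>
    rw [coeff_add, coeff_add]
    linear_combination hp + hq
  | smul_mem a p hp =>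
    rw [smul_eq_mul]
    induction a using MvPolynomial.induction_on' with
    | add a b ha hb =>
      rw [add_mul, coeff_add, coeff_add]
      linear_combination ha + hb
    | monomial m c =>
      have hsq (i : Fin 5) (hi : i ≠ 4) :
          coeff expVWXYZ (monomial m c * (X i : MvPolynomial (Fin 5) K) ^ 2) +
            6 * coeff expXYZCubed (monomial m c * (X i : MvPolynomial (Fin 5) K) ^ 2) = 0 := by
        rw [X_pow_eq_monomial, coeff_mul_monomial', coeff_mul_monomial', if_neg, if_neg]
        · simp
        all_goals
          rw [Finsupp.single_le_iff]
          fin_cases i <;> simp at hi ⊢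
      have hlast : coeff expVWXYZ (monomial m c * ((X 4) ^ 2 - 6 * (X 0 * X 1))) +
          6 * coeff expXYZCubed (monomial m c * ((X 4) ^ 2 - 6 * (X 0 * X 1))) = 0 := by
        have hiff : m + Finsupp.single 0 1 + Finsupp.single 1 1 = expVWXYZ ↔
            m + Finsupp.single 4 2 = expXYZCubed := by
          simp [Finsupp.ext_iff, Fin.forall_fin_succ, Finsupp.single_apply]
        have h₁ : m + Finsupp.single 4 2 ≠ expVWXYZ := fun h => by
          simpa using DFunLike.congr_fun h 4
        have h₂ : m + Finsupp.single 0 1 + Finsupp.single 1 1 ≠ expXYZCubed := fun h => by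
          simpa using DFunLike.congr_fun h 0
        rw [monomial_mul_sq_sub_six_mul, coeff_sub, coeff_sub, coeff_monomial, coeff_monomial,
          coeff_monomial, coeff_monomial, if_neg h₁, if_neg h₂]
        simp only [hiff]
        split_ifs <;> ring
      rcases hp with rfl | rfl | rfl | rfl | rfl
      · exact hsq 0 (by decide)
      · exact hsq 1 (by decide)
      · exact hsq 2 (by decide)
      · exact hsq 3 (by decide)
      · exact hlast

theorem monomial_mem_quadricIdeal_sup_restrictDegree {K : Type} [Field K] (e : Fin 5 →₀ ℕ)
    (c : K) :
    monomial e c ∈ (quadricIdeal K).restrictScalars K ⊔ restrictDegree (Fin 5) K 1 := by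
  classical
  induction h : e 4 using Nat.strong_induction_on generalizing e c with
  | h k ih =>
    by_cases he : ∀ i, e i ≤ 1
    · refine Submodule.mem_sup_right ((mem_restrictDegree _ _ _).mpr fun s hs => ?_)
      rwa [Finset.mem_singleton.mp (support_monomial_subset hs)]
    push Not at he
    obtain ⟨i, hi⟩ := he
    obtain ⟨d, rfl⟩ : ∃ d, e = d + Finsupp.single i 2 :=
      ⟨e - Finsupp.single i 2, (tsub_add_cancel_of_le (Finsupp.single_le_iff.mpr hi)).symm⟩
    have hmul : monomial (d + Finsupp.single i 2) c = monomial d c * (X i) ^ 2 := by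
      rw [X_pow_eq_monomial, monomial_mul, mul_one]
    by_cases hi4 : i = 4
    · subst hi4
      have hsplit : monomial (d + Finsupp.single 4 2) c =
          monomial d c * ((X 4) ^ 2 - 6 * (X 0 * X 1)) +
            monomial (d + Finsupp.single 0 1 + Finsupp.single 1 1) (6 * c) := by
        rw [monomial_mul_sq_sub_six_mul, sub_add_cancel]
      rw [hsplit]
      refine add_mem (Submodule.mem_sup_left ?_) (ih (d 4) ?_ _ _ ?_)
      · exact Ideal.mul_mem_left _ _ (Ideal.subset_span (by simp))
      · simp [← h]
      · simp
    · rw [hmul]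
      refine Submodule.mem_sup_left (Ideal.mul_mem_left _ _ (Ideal.subset_span ?_))
      fin_cases i <;> simp at hi4 ⊢

theorem quadricIdeal_sup_restrictDegree (K : Type) [Field K] :
    (quadricIdeal K).restrictScalars K ⊔ restrictDegree (Fin 5) K 1 = ⊤ := by
  refine eq_top_iff.mpr fun f _ => ?_
  induction f using MvPolynomial.induction_on' with
  | monomial e c => exact monomial_mem_quadricIdeal_sup_restrictDegree e c
  | add p q hp hq => exact add_mem (hp trivial) (hq trivial)

theorem eq_zero_of_mem_restrictDegree_of_coeff_add_six_mul_coeff {K : Type} [Field K]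
    {r : MvPolynomial (Fin 5) K} (hr : r ∈ restrictDegree (Fin 5) K 1)
    (h : ∀ m, coeff expVWXYZ (monomial m 1 * r) + 6 * coeff expXYZCubed (monomial m 1 * r) = 0) :
    r = 0 := by
  rw [mem_restrictDegree] at hr
  ext e
  by_contra hne
  have he := hr e (mem_support_iff.mpr hne)
  have hle : e ≤ expVWXYZ := fun i => (he i).trans (by fin_cases i <;> simp)
  have hm := h (expVWXYZ - e)
  have hB : coeff (expXYZCubed - (expVWXYZ - e)) r = 0 := by
    by_contra hB
    have := hr _ (mem_support_iff.mpr hB) 4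
    simp at this
    omega
  have hA : coeff expVWXYZ (monomial (expVWXYZ - e) 1 * r) = coeff e r := by
    rw [coeff_monomial_mul', if_pos tsub_le_self, tsub_tsub_cancel_of_le hle, one_mul]
  rw [hA, coeff_monomial_mul', hB, mul_zero, ite_self, mul_zero, add_zero] at hm
  exact hne hm

theorem isRegular_quadrics (K : Type) [Field K] :
    RingTheory.Sequence.IsRegular (MvPolynomial (Fin 5) K)
      [((X 0 : MvPolynomial (Fin 5) K)) ^ 2, (X 1) ^ 2, (X 2) ^ 2, (X 3) ^ 2,
        (X 4) ^ 2 - 6 * (X 0 * X 1)] := by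
  refine ⟨⟨fun i hi => ?_⟩, fun htop => ?_⟩
  · rw [smul_eq_mul, Ideal.mul_top]
    have hsq (s : Set (Fin 5)) (j : Fin 5) (hj : j ∉ s) (l : List (MvPolynomial (Fin 5) K))
        (hl : {r | r ∈ l} = (fun i => (X i : MvPolynomial (Fin 5) K) ^ 2) '' s) (k : ℕ) :
        IsSMulRegular (MvPolynomial (Fin 5) K ⧸ Ideal.ofList l)
          (X j ^ k : MvPolynomial (Fin 5) K) := by
      rw [Ideal.ofList, hl]
      exact isSMulRegular_quotient_span_X_sq_image hj k
    simp only [List.length_cons, List.length_nil] at hi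
    interval_cases i
    · exact hsq ∅ 0 (by simp) _ (by simp) 2
    · exact hsq {0} 1 (by simp) _ (by ext; simp) 2
    · exact hsq {0, 1} 2 (by simp) _ (by ext; simp [eq_comm]) 2
    · exact hsq {0, 1, 2} 3 (by simp) _ (by ext; simp [eq_comm]) 2
    · have h4 := hsq {0, 1, 2, 3} 4 (by simp)
        [(X 0) ^ 2, (X 1) ^ 2, (X 2) ^ 2, (X 3) ^ 2] (by ext; simp [eq_comm]) 4
      rw [isSMulRegular_quotient_iff_mem_of_smul_mem] at h4 ⊢
      intro f hf
      refine h4 f ?_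
      have hv : (X 0 : MvPolynomial (Fin 5) K) ^ 2 ∈
          Ideal.ofList [(X 0 : MvPolynomial (Fin 5) K) ^ 2, (X 1) ^ 2, (X 2) ^ 2, (X 3) ^ 2] :=
        Ideal.subset_span (by simp)
      have h : X 4 ^ 4 * f = (X 4 ^ 2 + 6 * (X 0 * X 1)) * ((X 4 ^ 2 - 6 * (X 0 * X 1)) * f) +
          36 * X 1 ^ 2 * f * X 0 ^ 2 := by
        ring
      rw [smul_eq_mul, h]
      exact add_mem (Ideal.mul_mem_left _ _ hf) (Ideal.mul_mem_left _ _ hv)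
  · rw [smul_eq_mul, Ideal.mul_top] at htop
    have hle : Ideal.ofList [((X 0 : MvPolynomial (Fin 5) K)) ^ 2, (X 1) ^ 2, (X 2) ^ 2, (X 3) ^ 2,
        (X 4) ^ 2 - 6 * (X 0 * X 1)] ≤ RingHom.ker (constantCoeff (R := K) (σ := Fin 5)) := by
      rw [Ideal.ofList, Ideal.span_le]
      intro r hr
      simp only [List.mem_cons, List.not_mem_nil, or_false, Set.mem_ofPred_eq] at hr
      rcases hr with rfl | rfl | rfl | rfl | rfl <;> simp
    exact RingHom.ker_ne_top _ (top_le_iff.mp (htop.trans_le hle))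

/-- For `F = vwxyz + xyz³` in `K[v,w,x,y,z]` (char `K` = 0),
`Ann_R(F) = (v², w², x², y², z² − 6vw)`, and these five quadratic forms form a
regular sequence in `R`; hence `A(F)` is a quadratic complete intersection.
Here `v = X 0`, `w = X 1`, `x = X 2`, `y = X 3`, `z = X 4`. -/
theorem ann_of_vwxyz_add_xyz_cubed {K : Type} [Field K] [CharZero K] :
    {f : MvPolynomial (Fin 5) K |
        contr ((X 0 : MvPolynomial (Fin 5) K) * X 1 * X 2 * X 3 * X 4
          + X 2 * X 3 * (X 4) ^ 3) f = 0}
      = ↑(Ideal.span ({(X 0) ^ 2, (X 1) ^ 2, (X 2) ^ 2, (X 3) ^ 2,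
          (X 4) ^ 2 - 6 * (X 0 * X 1)} : Set (MvPolynomial (Fin 5) K)))
    ∧ RingTheory.Sequence.IsRegular (MvPolynomial (Fin 5) K)
        [((X 0 : MvPolynomial (Fin 5) K)) ^ 2, (X 1) ^ 2, (X 2) ^ 2, (X 3) ^ 2,
          (X 4) ^ 2 - 6 * (X 0 * X 1)] := by
  refine ⟨Set.ext fun f => ?_, isRegular_quadrics K⟩
  rw [Set.mem_ofPred_eq, contr_vwxyz_add_xyz_cubed_eq_zero_iff, SetLike.mem_coe]
  constructor
  · intro hf
    obtain ⟨g, hg, r, hr, rfl⟩ := Submodule.mem_sup.mp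
      ((quadricIdeal_sup_restrictDegree K).ge (Submodule.mem_top (x := f)))
    suffices r = 0 by rwa [this, add_zero]
    refine eq_zero_of_mem_restrictDegree_of_coeff_add_six_mul_coeff hr fun m => ?_
    have h := coeff_add_six_mul_coeff_eq_zero_of_mem (Ideal.mul_mem_left _ (monomial m 1) hg)
    have hm := hf m
    rw [mul_add, coeff_add, coeff_add] at hm
    linear_combination hm - h
  · exact fun hf m => coeff_add_six_mul_coeff_eq_zero_of_mem (Ideal.mul_mem_left _ _ hf)
end
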